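/- Let X be a topological space that is not connected. Then there exists a binary relation R on X that is non-trivial, anti-symmetric, transitive and continuous, but not complete. (Consequently, connectedness of X is necessary for the conclusion that every non-trivial, transitive and continuous relation on X is complete.) -/

import Mathlib

/-- If a topological space is not connected (it is the union of two non-empty disjoint
open sets), then there is a non-trivial, anti-symmetric, transitive and continuous
binary relation on it which is not complete. -/
theorem disconnected_exists_incomplete_relation
    {X : Type*} [TopologicalSpace X]
    (hdisc : ∃ U V : Set X, IsOpen U ∧ IsOpen V ∧ U.Nonempty ∧ V.Nonempty ∧
      U ∩ V = ∅ ∧ U ∪ V = Set.univ) :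
    ∃ R : Set (X × X),
      -- non-trivial
      (∃ x y : X, (x, y) ∈ R ∧ (y, x) ∉ R) ∧
      -- anti-symmetric
      (∀ x y : X, (x, y) ∈ R → (y, x) ∈ R → x = y) ∧
      -- transitive
      (∀ x y z : X, (x, y) ∈ R → (y, z) ∈ R → (x, z) ∈ R) ∧
      -- continuous
      (∀ x : X, IsClosed {y | (x, y) ∈ R}) ∧
      (∀ x : X, IsClosed {y | (y, x) ∈ R}) ∧
      (∀ x : X, IsOpen {y | (x, y) ∈ R ∧ (y, x) ∉ R}) ∧
      (∀ x : X, IsOpen {y | (y, x) ∈ R ∧ (x, y) ∉ R}) ∧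
      -- not complete
      ¬(∀ x y : X, (x, y) ∈ R ∨ (y, x) ∈ R) := by
  obtain ⟨U, V, hU, hV, ⟨u, hu⟩, ⟨v, hv⟩, hUV, hcover⟩ := hdisc
  have hdisj : ∀ x, x ∈ U → x ∉ V := fun x hxU hxV => by
    have hx : x ∈ U ∩ V := ⟨hxU, hxV⟩
    simp [hUV] at hx
  have hcompl : IsCompl U V :=
    ⟨Set.disjoint_iff_inter_eq_empty.mpr hUV, codisjoint_iff.mpr hcover⟩
  have hUc : IsClosed U := by
    rw [← isOpen_compl_iff, hcompl.compl_eq]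
    exact hV
  have hVc : IsClosed V := by
    rw [← isOpen_compl_iff, hcompl.symm.compl_eq]
    exact hU
  have hasymm : ∀ x y, (x, y) ∈ U ×ˢ V → (y, x) ∉ U ×ˢ V :=
    fun x y hxy hyx => hdisj x hxy.1 hyx.2
  have hP : ∀ x y, ((x, y) ∈ U ×ˢ V ∧ (y, x) ∉ U ×ˢ V) ↔ x ∈ U ∧ y ∈ V :=
    fun x y => ⟨fun h => h.1, fun h => ⟨h, hasymm x y h⟩⟩
  refine ⟨U ×ˢ V, ⟨u, v, (hP u v).mpr ⟨hu, hv⟩⟩,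
    fun x y hxy hyx => absurd hyx (hasymm x y hxy),
    fun x y z hxy hyz => absurd hxy.2 (hdisj y hyz.1), fun x => ?_, fun x => ?_,
    fun x => ?_, fun x => ?_, fun h => (h u u).elim (fun h => hdisj u hu h.2)
      (fun h => hdisj u hu h.2)⟩
  · exact (isClosed_const (p := x ∈ U)).inter hVc
  · exact hUc.inter (isClosed_const (p := x ∈ V))
  · simp only [hP]
    exact isOpen_const.and hV
  · simp only [hP]
    exact hU.and isOpen_const
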